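/- The following are equivalent for a finite-dimensional basic algebra A over a field K: (a) mod A has only finitely many torsion classes; (b) there are only finitely many bricks in mod A up to isomorphism; (c) there are only finitely many left finite bricks in mod A up to isomorphism. -/

import Mathlib

/-! Common definitions: finite-dimensional modules over a finite-dimensional algebra,
quotient modules, dimension vectors via composition series, Newton polytopes,
torsion classes, `Fac`, τ-rigidity, bricks, etc. -/

variable (A : Type) [Ring A]

/-- `X` is a quotient module of `M`. -/
def IsQuotientOf (M X : ModuleCat.{0} A) : Prop :=
  ∃ f : M →ₗ[A] X, Function.Surjective f

open Classical in
/-- The dimension vector of a module `M`, relative to a family `S : Fin n → ModuleCat A`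
of (representatives of the isomorphism classes of the) simple `A`-modules: its `i`-th entry
is the multiplicity of `S i` as a composition factor of `M` (well defined by Jordan–Hölder,
for `M` of finite length). -/
noncomputable def dimVec {n : ℕ} (S : Fin n → ModuleCat.{0} A)
    (M : Type) [AddCommGroup M] [Module A M] : Fin n → ℕ := fun i =>
  if h : ∃ s : CompositionSeries (Submodule A M),
      RelSeries.head s = ⊥ ∧ RelSeries.last s = ⊤ then
    Nat.card {j : Fin h.choose.length //
      Nonempty ((↥(h.choose j.succ) ⧸
        (Submodule.comap (h.choose j.succ).subtype
          (h.choose j.castSucc))) ≃ₗ[A] S i)}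
  else 0

/-- The Newton polytope of `U`: the convex hull in `ℝⁿ` of the dimension vectors of
the quotient modules of `U`. -/
noncomputable def newtonPolytope {n : ℕ} (S : Fin n → ModuleCat.{0} A)
    (U : ModuleCat.{0} A) : Set (Fin n → ℝ) :=
  convexHull ℝ { v : Fin n → ℝ | ∃ p : Submodule A U,
    v = fun i => ((dimVec A S (↥U ⧸ p) i : ℕ) : ℝ) }

/-- `Fac M`: the class of quotient modules of finite direct sums of copies of `M`. -/
def Fac (M : ModuleCat.{0} A) : Set (ModuleCat.{0} A) :=
  { X | ∃ (k : ℕ) (f : (Fin k → M) →ₗ[A] X), Function.Surjective f }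

/-- A torsion class in `mod A`: a class of finite-dimensional `A`-modules closed under
isomorphisms, quotient modules and extensions. -/
def IsTorsionClass (T : Set (ModuleCat.{0} A)) : Prop :=
  (∀ M ∈ T, Module.Finite A M) ∧
  (∀ M ∈ T, ∀ N : ModuleCat.{0} A, Nonempty (M ≃ₗ[A] N) → N ∈ T) ∧
  (∀ M ∈ T, ∀ X : ModuleCat.{0} A, IsQuotientOf A M X → X ∈ T) ∧
  (∀ (L E N : ModuleCat.{0} A) (f : L →ₗ[A] E) (g : E →ₗ[A] N),
    Function.Injective f → Function.Surjective g →
    LinearMap.range f = LinearMap.ker g → L ∈ T → N ∈ T → E ∈ T)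

/-- `⟨N⟩_tors`, the smallest torsion class containing `N`. -/
def torsGen (N : ModuleCat.{0} A) : Set (ModuleCat.{0} A) :=
  ⋂₀ { T | IsTorsionClass A T ∧ N ∈ T }

/-- A module `N` is left finite if the torsion class it generates is functorially finite,
i.e. `⟨N⟩_tors = Fac M` for some `M` in `mod A`. -/
def LeftFinite (N : ModuleCat.{0} A) : Prop :=
  ∃ M : ModuleCat.{0} A, Module.Finite A M ∧ torsGen A N = Fac A M

/-- `M` is τ-rigid: `Ext¹(M, X) = 0` for every `X ∈ Fac M`, expressed by the splitting of
every short exact sequence `0 → X → E → M → 0`. -/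
def IsTauRigid (M : ModuleCat.{0} A) : Prop :=
  ∀ X ∈ Fac A M, ∀ (E : ModuleCat.{0} A) (f : X →ₗ[A] E) (g : E →ₗ[A] M),
    Function.Injective f → Function.Surjective g → LinearMap.range f = LinearMap.ker g →
    ∃ s : M →ₗ[A] E, g.comp s = LinearMap.id

/-- `M` is indecomposable. -/
def Indecomposable (M : ModuleCat.{0} A) : Prop :=
  Nontrivial M ∧ ∀ (M₁ M₂ : ModuleCat.{0} A),
    Nonempty (M ≃ₗ[A] (M₁ × M₂)) → (Subsingleton M₁ ∨ Subsingleton M₂)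

/-- `M` is a brick: its endomorphism ring is a division ring, i.e. `M ≠ 0` and every
nonzero endomorphism of `M` is invertible. -/
def IsBrick (M : ModuleCat.{0} A) : Prop :=
  Nontrivial M ∧ ∀ f : M →ₗ[A] M, f ≠ 0 → Function.Bijective f

/-- The setoid identifying isomorphic modules, restricted to modules satisfying `P`. -/
def isoSetoid (P : ModuleCat.{0} A → Prop) : Setoid {M : ModuleCat.{0} A // P M} where
  r M N := Nonempty (M.1 ≃ₗ[A] N.1)
  iseqv := ⟨fun M => ⟨LinearEquiv.refl A M.1⟩, fun ⟨e⟩ => ⟨e.symm⟩,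
    fun ⟨e⟩ ⟨f⟩ => ⟨e.trans f⟩⟩

section TorsionClasses

variable {A}

namespace IsTorsionClass

variable {T : Set (ModuleCat.{0} A)} {X Y : Type} [AddCommGroup X] [Module A X]
  [AddCommGroup Y] [Module A Y]

theorem finite (hT : IsTorsionClass A T) (h : ModuleCat.of A X ∈ T) : Module.Finite A X :=
  hT.1 _ h

theorem of_surjective (hT : IsTorsionClass A T) (h : ModuleCat.of A X ∈ T) (f : X →ₗ[A] Y)
    (hf : Function.Surjective f) : ModuleCat.of A Y ∈ T :=
  hT.2.2.1 _ h (ModuleCat.of A Y) ⟨f, hf⟩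

theorem of_equiv (hT : IsTorsionClass A T) (h : ModuleCat.of A X ∈ T) (e : X ≃ₗ[A] Y) :
    ModuleCat.of A Y ∈ T :=
  hT.of_surjective h e.toLinearMap e.surjective

theorem of_ker (hT : IsTorsionClass A T) (g : X →ₗ[A] Y) (hg : Function.Surjective g)
    (hk : ModuleCat.of A (LinearMap.ker g) ∈ T) (hY : ModuleCat.of A Y ∈ T) :
    ModuleCat.of A X ∈ T :=
  hT.2.2.2 (ModuleCat.of A (LinearMap.ker g)) (ModuleCat.of A X) (ModuleCat.of A Y)
    (LinearMap.ker g).subtype g (Submodule.injective_subtype _) hg (Submodule.range_subtype _)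
    hk hY

theorem of_subsingleton (hT : IsTorsionClass A T) (hne : T.Nonempty) [Subsingleton X] :
    ModuleCat.of A X ∈ T := by
  obtain ⟨M, hM⟩ := hne
  exact hT.of_surjective (X := M) hM 0 fun x => ⟨0, Subsingleton.elim _ _⟩

theorem range_mem (hT : IsTorsionClass A T) (h : ModuleCat.of A X ∈ T) (f : X →ₗ[A] Y) :
    ModuleCat.of A (LinearMap.range f) ∈ T :=
  hT.of_surjective h f.rangeRestrict f.surjective_rangeRestrict

theorem prod (hT : IsTorsionClass A T) (hX : ModuleCat.of A X ∈ T)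
    (hY : ModuleCat.of A Y ∈ T) : ModuleCat.of A (X × Y) ∈ T := by
  refine hT.of_ker (LinearMap.snd A X Y) LinearMap.snd_surjective ?_ hY
  refine hT.of_surjective hX
    ((LinearMap.inl A X Y).codRestrict (LinearMap.ker (LinearMap.snd A X Y)) (by simp)) ?_
  rintro ⟨⟨x, y⟩, h⟩
  have : y = 0 := by simpa using h
  exact ⟨x, Subtype.ext (Prod.ext rfl this.symm)⟩

theorem pi (hT : IsTorsionClass A T) (hX : ModuleCat.of A X ∈ T) (k : ℕ) :
    ModuleCat.of A (Fin k → X) ∈ T := by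
  induction k with
  | zero => exact hT.of_subsingleton ⟨_, hX⟩
  | succ k ih => exact hT.of_equiv (hT.prod hX ih) (Fin.consLinearEquiv A fun _ => X)

theorem sup (hT : IsTorsionClass A T) {S S' : Submodule A X} (hS : ModuleCat.of A S ∈ T)
    (hS' : ModuleCat.of A S' ∈ T) : ModuleCat.of A (S ⊔ S' : Submodule A X) ∈ T := by
  have h := hT.range_mem (hT.prod hS hS') (S.subtype.coprod S'.subtype)
  rwa [LinearMap.range_coprod, Submodule.range_subtype, Submodule.range_subtype] at h

/-- The preimage of a member of a torsion class under a quotient map by another member. -/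
theorem comap_mkQ (hT : IsTorsionClass A T) {S : Submodule A X} (hS : ModuleCat.of A S ∈ T)
    {R : Submodule A (X ⧸ S)} (hR : ModuleCat.of A R ∈ T) :
    ModuleCat.of A (R.comap S.mkQ) ∈ T := by
  let g : R.comap S.mkQ →ₗ[A] R := S.mkQ.restrict fun x hx => hx
  refine hT.of_ker g ?_ ?_ hR
  · rintro ⟨y, hy⟩
    obtain ⟨x, rfl⟩ := S.mkQ_surjective y
    exact ⟨⟨x, hy⟩, rfl⟩
  · have hle : S ≤ R.comap S.mkQ := fun x hx => by
      have h0 : S.mkQ x = 0 := by simpa using hx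
      rw [Submodule.mem_comap, h0]
      exact R.zero_mem
    refine hT.of_surjective hS ((Submodule.inclusion hle).codRestrict (LinearMap.ker g) ?_) ?_
    · rintro ⟨x, hx⟩
      rw [LinearMap.mem_ker]
      exact Subtype.ext (by simpa [g] using hx)
    · rintro ⟨⟨x, hx⟩, h⟩
      have : S.mkQ x = 0 := congrArg Subtype.val h
      exact ⟨⟨x, by simpa using this⟩, rfl⟩

theorem fac_subset (hT : IsTorsionClass A T) {M : ModuleCat.{0} A} (hM : M ∈ T) :
    Fac A M ⊆ T := by
  rintro Y ⟨k, f, hf⟩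
  exact hT.of_surjective (hT.pi (X := M) hM k) f hf

/-- Every submodule contains a largest submodule belonging to a given torsion class. -/
theorem exists_greatest (hT : IsTorsionClass A T) (hne : T.Nonempty) [IsNoetherian A X]
    (K : Submodule A X) : ∃ S ≤ K, ModuleCat.of A S ∈ T ∧
      ∀ S' ≤ K, ModuleCat.of A S' ∈ T → S' ≤ S := by
  obtain ⟨S, ⟨hSK, hS⟩, hmax⟩ := WellFounded.has_min
    (wellFounded_gt : WellFounded ((· > ·) : Submodule A X → Submodule A X → Prop))
    {S | S ≤ K ∧ ModuleCat.of A S ∈ T} ⟨⊥, bot_le, hT.of_subsingleton hne⟩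
  refine ⟨S, hSK, hS, fun S' hS'K hS' => ?_⟩
  by_contra hlt
  exact hmax (S ⊔ S') ⟨sup_le hSK hS'K, hT.sup hS hS'⟩ (left_lt_sup.2 hlt)

theorem iSup_mem (hT : IsTorsionClass A T) (hne : T.Nonempty) [IsNoetherian A X] {ι : Sort*}
    (S : ι → Submodule A X) (hS : ∀ i, ModuleCat.of A (S i) ∈ T) :
    ModuleCat.of A (⨆ i, S i : Submodule A X) ∈ T := by
  obtain ⟨R, hRle, hR, hmax⟩ := hT.exists_greatest hne (⨆ i, S i)
  have : R = ⨆ i, S i := le_antisymm hRle (iSup_le fun i => hmax _ (le_iSup S i) (hS i))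
  rwa [← this]

end IsTorsionClass

/-- `H` receives no nonzero map from a member of `U`. -/
def IsTorsionFree (U : Set (ModuleCat.{0} A)) (H : Type) [AddCommGroup H] [Module A H] : Prop :=
  ∀ Y : ModuleCat.{0} A, Y ∈ U → ∀ f : Y →ₗ[A] H, f = 0

theorem IsTorsionFree.eq_zero {U : Set (ModuleCat.{0} A)} {H Y : Type} [AddCommGroup H]
    [Module A H] [AddCommGroup Y] [Module A Y] (h : IsTorsionFree U H)
    (hY : ModuleCat.of A Y ∈ U) (f : Y →ₗ[A] H) : f = 0 :=
  h (ModuleCat.of A Y) hY f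

theorem IsTorsionFree.of_injective {U : Set (ModuleCat.{0} A)} {H Y : Type} [AddCommGroup H]
    [Module A H] [AddCommGroup Y] [Module A Y] (h : IsTorsionFree U H)
    (g : Y →ₗ[A] H) (hg : Function.Injective g) : IsTorsionFree U Y := by
  intro Z hZ f
  ext z
  exact hg (by simpa using LinearMap.congr_fun (h Z hZ (g ∘ₗ f)) z)

namespace IsTorsionClass

variable {T : Set (ModuleCat.{0} A)} {X Y : Type} [AddCommGroup X] [Module A X]
  [AddCommGroup Y] [Module A Y]

/-- Members of `T` mapping to a quotient by a greatest submodule in `T` inside `K`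
cannot land in the image of `K`. -/
theorem eq_zero_of_greatest (hT : IsTorsionClass A T) {K S : Submodule A X}
    (hS : ModuleCat.of A S ∈ T) (hmax : ∀ S' ≤ K, ModuleCat.of A S' ∈ T → S' ≤ S)
    (hY : ModuleCat.of A Y ∈ T) (f : Y →ₗ[A] X ⧸ S)
    (hf : (LinearMap.range f).comap S.mkQ ≤ K) : f = 0 := by
  have h := hmax _ hf (hT.comap_mkQ hS (hT.range_mem hY f))
  ext y
  obtain ⟨x, hx⟩ := S.mkQ_surjective (f y)
  have hxS : x ∈ S := h (by rw [Submodule.mem_comap, hx]; exact ⟨y, rfl⟩)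
  rw [← hx]
  simpa using hxS

theorem exists_radical (hT : IsTorsionClass A T) (hne : T.Nonempty) (X : Type) [AddCommGroup X]
    [Module A X] [IsNoetherian A X] :
    ∃ S : Submodule A X, ModuleCat.of A S ∈ T ∧
      (∀ S' : Submodule A X, ModuleCat.of A S' ∈ T → S' ≤ S) ∧ IsTorsionFree T (X ⧸ S) := by
  obtain ⟨S, -, hS, hmax⟩ := hT.exists_greatest hne (⊤ : Submodule A X)
  exact ⟨S, hS, fun S' => hmax S' le_top, fun Y hY f =>
    hT.eq_zero_of_greatest (Y := Y) hS hmax hY f le_top⟩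

/-- The members of a torsion class without nonzero map to `E` form a torsion class. -/
theorem inter_perp (hT : IsTorsionClass A T) (E : Type) [AddCommGroup E] [Module A E] :
    IsTorsionClass A {Y | Y ∈ T ∧ ∀ f : Y →ₗ[A] E, f = 0} := by
  refine ⟨fun M hM => hT.1 M hM.1, fun M hM N ⟨e⟩ => ⟨hT.2.1 M hM.1 N ⟨e⟩, fun f => ?_⟩,
    fun M hM N ⟨g, hg⟩ => ⟨hT.2.2.1 M hM.1 N ⟨g, hg⟩, fun f => ?_⟩, ?_⟩
  · ext x
    simpa using LinearMap.congr_fun (hM.2 (f ∘ₗ e.toLinearMap)) (e.symm x)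
  · ext x
    obtain ⟨y, rfl⟩ := hg x
    exact LinearMap.congr_fun (hM.2 (f ∘ₗ g)) y
  · intro L F N i g hi hg hex hL hN
    refine ⟨hT.2.2.2 L F N i g hi hg hex hL.1 hN.1, fun f => ?_⟩
    have hker : LinearMap.ker g ≤ LinearMap.ker f := by
      rw [← hex]
      rintro _ ⟨l, rfl⟩
      exact LinearMap.congr_fun (hL.2 (f ∘ₗ i)) l
    let e := g.quotKerEquivOfSurjective hg
    have h0 := hN.2 ((LinearMap.ker g).liftQ f hker ∘ₗ e.symm.toLinearMap)
    ext x
    have := LinearMap.congr_fun h0 (g x)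
    have he : e.symm (g x) = (LinearMap.ker g).mkQ x := by
      rw [LinearEquiv.symm_apply_eq]
      rfl
    rw [LinearMap.comp_apply, LinearEquiv.coe_coe, he] at this
    simpa using this

end IsTorsionClass

/-! ### The class `Fac M` -/

theorem mem_Fac_of_fintype {M : ModuleCat.{0} A} {X : Type} [AddCommGroup X] [Module A X]
    {ι : Type} [Finite ι] (f : (ι → M) →ₗ[A] X) (hf : Function.Surjective f) :
    ModuleCat.of A X ∈ Fac A M := by
  have := Fintype.ofFinite ι
  let e := LinearEquiv.funCongrLeft A M (Fintype.equivFin ι)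
  exact ⟨Fintype.card ι, f ∘ₗ e.toLinearMap, hf.comp e.surjective⟩

theorem self_mem_Fac (M : ModuleCat.{0} A) : M ∈ Fac A M :=
  mem_Fac_of_fintype (X := M) (ι := Unit) (LinearMap.proj ()) fun x => ⟨fun _ => x, rfl⟩

theorem Fac_of_surjective {M : ModuleCat.{0} A} {X Y : Type} [AddCommGroup X] [Module A X]
    [AddCommGroup Y] [Module A Y] (h : ModuleCat.of A X ∈ Fac A M) (f : X →ₗ[A] Y)
    (hf : Function.Surjective f) : ModuleCat.of A Y ∈ Fac A M := by
  obtain ⟨k, g, hg⟩ := h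
  exact ⟨k, f ∘ₗ g, hf.comp hg⟩

theorem Fac_trans {M N X : ModuleCat.{0} A} (hN : N ∈ Fac A M) (hX : X ∈ Fac A N) :
    X ∈ Fac A M := by
  obtain ⟨k, f, hf⟩ := hN
  obtain ⟨l, g, hg⟩ := hX
  let F : (Fin l × Fin k → M) →ₗ[A] (Fin l → N) :=
    LinearMap.pi fun i => f ∘ₗ LinearMap.funLeft A M fun j => (i, j)
  refine mem_Fac_of_fintype (X := X) (g ∘ₗ F) (hg.comp fun y => ?_)
  choose x hx using fun i => hf (y i)
  exact ⟨fun p => x p.1 p.2, funext fun i => hx i⟩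

theorem finite_of_mem_Fac {M X : ModuleCat.{0} A} [Module.Finite A M] (h : X ∈ Fac A M) :
    Module.Finite A X := by
  obtain ⟨k, f, hf⟩ := h
  exact Module.Finite.of_surjective f hf

/-! ### Torsion classes covered by a given one -/

/-- `U` is a maximal nonempty proper torsion subclass of `T`. -/
structure IsTorsionCover (U T : Set (ModuleCat.{0} A)) : Prop where
  left : IsTorsionClass A U
  right : IsTorsionClass A T
  nonempty : U.Nonempty
  ssubset : U ⊂ T
  eq_of_ssubset : ∀ V, IsTorsionClass A V → U ⊂ V → V ⊆ T → V = T

/-- A label of the cover `U ⊂ T`: a nonzero `U`-torsion-free module in `T` such that every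
nonzero map to it from a member of `T` is surjective. -/
structure IsLabel (U T : Set (ModuleCat.{0} A)) (B : Type) [AddCommGroup B] [Module A B] :
    Prop where
  mem : ModuleCat.of A B ∈ T
  nontrivial : Nontrivial B
  torsionFree : IsTorsionFree U B
  surjective : ∀ Y : ModuleCat.{0} A, Y ∈ T → ∀ f : Y →ₗ[A] B, f ≠ 0 → Function.Surjective f

theorem IsTorsionCover.exists_label [IsArtinianRing A] {U T : Set (ModuleCat.{0} A)}
    (h : IsTorsionCover U T) : ∃ B : ModuleCat.{0} A, IsLabel U T B := by
  obtain ⟨Z, hZT, hZU⟩ := Set.exists_of_ssubset h.ssubset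
  have := h.right.1 Z hZT
  obtain ⟨S, hS, -, hfree⟩ := h.left.exists_radical h.nonempty Z
  have hST : S ≠ ⊤ := by
    rintro rfl
    exact hZU (h.left.of_equiv hS Submodule.topEquiv)
  have hnt : Nontrivial (Z ⧸ S) := Submodule.Quotient.nontrivial_iff.2 hST
  have hQT : ModuleCat.of A (Z ⧸ S) ∈ T :=
    h.right.of_surjective (X := Z) hZT S.mkQ S.mkQ_surjective
  obtain ⟨B, ⟨hB0, hBT⟩, hmin⟩ := WellFounded.has_min
    (wellFounded_lt : WellFounded ((· < ·) : Submodule A (Z ⧸ S) → Submodule A (Z ⧸ S) → Prop))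
    {B | B ≠ ⊥ ∧ ModuleCat.of A B ∈ T} ⟨⊤, top_ne_bot, h.right.of_equiv hQT
      Submodule.topEquiv.symm⟩
  refine ⟨ModuleCat.of A B, hBT, Submodule.nontrivial_iff_ne_bot.2 hB0,
    hfree.of_injective B.subtype B.injective_subtype, fun Y hY f hf => ?_⟩
  have hR := h.right.range_mem (X := Y) hY (B.subtype ∘ₗ f)
  have hRB : LinearMap.range (B.subtype ∘ₗ f) ≤ B := by
    rintro _ ⟨y, rfl⟩
    exact (f y).2
  have hR0 : LinearMap.range (B.subtype ∘ₗ f) ≠ ⊥ := by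
    intro h0
    rw [LinearMap.range_eq_bot] at h0
    apply hf
    ext y
    exact LinearMap.congr_fun h0 y
  have heq : LinearMap.range (B.subtype ∘ₗ f) = B := by
    by_contra hne
    exact hmin _ ⟨hR0, hR⟩ (lt_of_le_of_ne hRB hne)
  intro b
  have hb : (b : Z ⧸ S) ∈ LinearMap.range (B.subtype ∘ₗ f) := by
    rw [heq]
    exact b.2
  obtain ⟨y, hy⟩ := hb
  exact ⟨y, Subtype.ext hy⟩

section Label

variable {U T : Set (ModuleCat.{0} A)} {B : Type} [AddCommGroup B] [Module A B]

theorem IsTorsionCover.mem_of_forall_eq_zero (h : IsTorsionCover U T) (hB : IsLabel U T B)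
    {Y : Type} [AddCommGroup Y] [Module A Y] (hY : ModuleCat.of A Y ∈ T)
    (hYB : ∀ f : Y →ₗ[A] B, f = 0) : ModuleCat.of A Y ∈ U := by
  set V := {Y : ModuleCat.{0} A | Y ∈ T ∧ ∀ f : Y →ₗ[A] B, f = 0} with hV
  by_contra hYU
  have hUV : U ⊂ V := by
    refine (Set.ssubset_iff_of_subset fun Z hZ => ?_).2 ⟨ModuleCat.of A Y, ⟨hY, hYB⟩, hYU⟩
    exact ⟨h.ssubset.1 hZ, fun f => hB.torsionFree Z hZ f⟩
  have hVT := h.eq_of_ssubset V (h.right.inter_perp B) hUV fun Z hZ => hZ.1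
  have hBV : ModuleCat.of A B ∈ V := hVT ▸ hB.mem
  have hid : (LinearMap.id : B →ₗ[A] B) = 0 := hBV.2 LinearMap.id
  have := hB.nontrivial
  obtain ⟨b, hb⟩ := exists_ne (0 : B)
  exact hb (LinearMap.congr_fun hid b)

theorem IsTorsionCover.ker_mem [IsArtinianRing A] (h : IsTorsionCover U T)
    (hB : IsLabel U T B) {Y : Type} [AddCommGroup Y] [Module A Y] (hY : ModuleCat.of A Y ∈ T)
    (g : Y →ₗ[A] B) (hg : Function.Surjective g) : ModuleCat.of A (LinearMap.ker g) ∈ T := by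
  have := h.right.finite hY
  have := h.right.finite hB.mem
  obtain ⟨S, hSK, hS, hmax⟩ := h.right.exists_greatest (h.nonempty.mono h.ssubset.1)
    (LinearMap.ker g)
  have hE : ModuleCat.of A (Y ⧸ S) ∈ T := h.right.of_surjective hY S.mkQ S.mkQ_surjective
  let g' : (Y ⧸ S) →ₗ[A] B := S.liftQ g hSK
  have key : ∀ Z : ModuleCat.{0} A, Z ∈ T → ∀ f : Z →ₗ[A] Y ⧸ S, g' ∘ₗ f = 0 → f = 0 := by
    intro Z hZ f hf
    refine h.right.eq_zero_of_greatest (Y := Z) hS hmax hZ f ?_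
    rintro y ⟨z, hz⟩
    have := LinearMap.congr_fun hf z
    rw [LinearMap.comp_apply, hz] at this
    simpa [g'] using this
  have hfree : IsTorsionFree U (Y ⧸ S) := fun Z hZ f =>
    key Z (h.ssubset.1 hZ) f (hB.torsionFree Z hZ _)
  have hnt := hB.nontrivial
  obtain ⟨b, hb⟩ : ∃ b : B →ₗ[A] Y ⧸ S, b ≠ 0 := by
    by_contra hcon
    push Not at hcon
    set V := {Z : ModuleCat.{0} A | Z ∈ T ∧ ∀ f : Z →ₗ[A] (Y ⧸ S), f = 0} with hV
    have hUV : U ⊂ V := by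
      refine (Set.ssubset_iff_of_subset fun Z hZ => ?_).2
        ⟨ModuleCat.of A B, ⟨hB.mem, hcon⟩, fun hBU => ?_⟩
      · exact ⟨h.ssubset.1 hZ, fun f => hfree Z hZ f⟩
      · obtain ⟨x, hx⟩ := exists_ne (0 : B)
        exact hx (LinearMap.congr_fun (hB.torsionFree.eq_zero hBU LinearMap.id) x)
    have hVT := h.eq_of_ssubset V (h.right.inter_perp _) hUV fun Z hZ => hZ.1
    have hEV : ModuleCat.of A (Y ⧸ S) ∈ V := hVT ▸ hE
    have hid : (LinearMap.id : (Y ⧸ S) →ₗ[A] Y ⧸ S) = 0 := hEV.2 LinearMap.id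
    obtain ⟨x, hx⟩ := exists_ne (0 : B)
    obtain ⟨y, rfl⟩ := hg x
    apply hx
    have : g' (S.mkQ y) = 0 := by
      rw [show S.mkQ y = 0 from LinearMap.congr_fun hid (S.mkQ y), map_zero]
    simpa [g'] using this
  have hgb : g' ∘ₗ b ≠ 0 := fun h0 => hb (key (ModuleCat.of A B) hB.mem b h0)
  have hsurj : Function.Surjective (g' ∘ₗ b) := hB.surjective (ModuleCat.of A B) hB.mem _ hgb
  have hbij := IsNoetherian.bijective_of_surjective_endomorphism _ hsurj
  let e := LinearEquiv.ofBijective (g' ∘ₗ b) hbij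
  have hp := key (ModuleCat.of A (Y ⧸ S)) hE
    (LinearMap.id - b ∘ₗ e.symm.toLinearMap ∘ₗ g') (by
      ext y
      have := e.apply_symm_apply (g' (S.mkQ y))
      have h2 : g' (b (e.symm (g' (S.mkQ y)))) = g' (S.mkQ y) := this
      simpa [sub_eq_zero] using h2.symm)
  have hKS : LinearMap.ker g = S := by
    refine le_antisymm (fun y hy => ?_) hSK
    have := LinearMap.congr_fun hp (S.mkQ y)
    have hgy : g' (S.mkQ y) = 0 := by simpa [g'] using hy
    have h3 : S.mkQ y - b (e.symm (g' (S.mkQ y))) = 0 := this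
    rw [hgy, map_zero, map_zero, sub_zero] at h3
    simpa using h3
  rwa [hKS]

/-- A quotient of a `U`-torsion-free member of `T` by a member of `T` is again
`U`-torsion-free; in particular it is zero if it lies in `U`. -/
theorem IsTorsionCover.subsingleton_of_surjective [IsArtinianRing A] (h : IsTorsionCover U T)
    (hB : IsLabel U T B) {W : Type} [AddCommGroup W] [Module A W]
    (hW : ModuleCat.of A W ∈ U) (n : ℕ) : ∀ {H : Type} [AddCommGroup H] [Module A H]
    (_ : Module.length A H ≤ n) (_ : ModuleCat.of A H ∈ T) (_ : IsTorsionFree U H)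
    (π : H →ₗ[A] W) (_ : Function.Surjective π)
    (_ : ModuleCat.of A (LinearMap.ker π) ∈ T), Subsingleton W := by
  induction n with
  | zero =>
    intro H _ _ hlen hH hfree π hπ hk
    have : Subsingleton H := Module.length_eq_zero_iff.1 (by simpa using hlen)
    exact hπ.subsingleton
  | succ n ih =>
    intro H _ _ hlen hH hfree π hπ hk
    have := h.right.finite hH
    by_cases hcase : ∀ f : H →ₗ[A] B, f = 0
    · have hid := hfree.eq_zero (h.mem_of_forall_eq_zero hB hH hcase) LinearMap.id
      have : Subsingleton H := ⟨fun x y => by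
        rw [show x = 0 from LinearMap.congr_fun hid x, show y = 0 from LinearMap.congr_fun hid y]⟩
      exact hπ.subsingleton
    push Not at hcase
    obtain ⟨g, hg⟩ := hcase
    have hgk : g ∘ₗ (LinearMap.ker π).subtype ≠ 0 := by
      intro h0
      have hle : LinearMap.ker π ≤ LinearMap.ker g := fun x hx =>
        LinearMap.congr_fun h0 ⟨x, hx⟩
      have h1 := hB.torsionFree.eq_zero hW
        ((LinearMap.ker π).liftQ g hle ∘ₗ (π.quotKerEquivOfSurjective hπ).symm.toLinearMap)
      apply hg
      ext x
      have h2 := LinearMap.congr_fun h1 (π x)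
      have he : (π.quotKerEquivOfSurjective hπ).symm (π x) = (LinearMap.ker π).mkQ x := by
        rw [LinearEquiv.symm_apply_eq]
        rfl
      rw [LinearMap.comp_apply, LinearEquiv.coe_coe, he] at h2
      simpa using h2
    have hgsurj : Function.Surjective g := hB.surjective (ModuleCat.of A H) hH g hg
    have hgksurj : Function.Surjective (g ∘ₗ (LinearMap.ker π).subtype) :=
      hB.surjective (ModuleCat.of A (LinearMap.ker π)) hk _ hgk
    have hnt := hB.nontrivial
    have hne : LinearMap.ker g ≠ ⊤ := fun ht => hg (LinearMap.ker_eq_top.1 ht)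
    have hlt : Module.length A (LinearMap.ker g) < Module.length A H := Submodule.length_lt hne
    refine ih (H := LinearMap.ker g) ?_ (h.ker_mem hB hH g hgsurj)
      (hfree.of_injective _ (Submodule.injective_subtype _))
      (π ∘ₗ (LinearMap.ker g).subtype) ?_ ?_
    · have := hlt.trans_le hlen
      rw [Nat.cast_add, Nat.cast_one] at this
      exact Order.le_of_lt_add_one this
    · intro w
      obtain ⟨x, rfl⟩ := hπ w
      obtain ⟨z, hz⟩ := hgksurj (g x)
      refine ⟨⟨x - z, ?_⟩, ?_⟩
      · rw [LinearMap.mem_ker, map_sub, sub_eq_zero]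
        exact hz.symm
      · simp
    · have hkk := h.ker_mem hB hk _ hgksurj
      let F : LinearMap.ker (g ∘ₗ (LinearMap.ker π).subtype) →ₗ[A] LinearMap.ker g :=
        ((LinearMap.ker π).subtype ∘ₗ Submodule.subtype _).codRestrict _ fun x => x.2
      refine h.right.of_surjective hkk (F.codRestrict _ fun x => ?_) ?_
      · exact x.1.2
      · rintro ⟨⟨x, hxg⟩, hxπ⟩
        exact ⟨⟨⟨x, hxπ⟩, hxg⟩, rfl⟩

end Label

/-! ### Universal elements and functorially finite torsion classes -/

/-- Every element of a member of `T` is the image of `p ∈ P`: the map `A → P`, `1 ↦ p`, is a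
left `T`-approximation of the regular module. -/
structure IsUniversal (T : Set (ModuleCat.{0} A)) {P : Type} [AddCommGroup P] [Module A P]
    (p : P) : Prop where
  mem : ModuleCat.of A P ∈ T
  exists_map : ∀ Y : ModuleCat.{0} A, Y ∈ T → ∀ y : Y, ∃ f : P →ₗ[A] Y, f p = y

theorem isUniversal_pi_basis (K : Type) [Field K] [Algebra K A] {M : ModuleCat.{0} A}
    [Module K M] [IsScalarTower K A M] (hT : IsTorsionClass A (Fac A M)) {n : ℕ}
    (b : Module.Basis (Fin n) K M) : IsUniversal (Fac A M) (P := Fin n → M) b := by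
  refine ⟨hT.pi (self_mem_Fac M) n, ?_⟩
  rintro Y ⟨k, f, hf⟩ y
  obtain ⟨m, rfl⟩ := hf y
  have : SMulCommClass A K M := IsScalarTower.to_smulCommClass'
  let F : (Fin n → M) →ₗ[A] (Fin k → M) :=
    LinearMap.pi fun j => ∑ i, (b.repr (m j) i) • (LinearMap.proj i : (Fin n → M) →ₗ[A] M)
  refine ⟨f ∘ₗ F, congrArg f (funext fun j => ?_)⟩
  simp only [F, LinearMap.pi_apply, LinearMap.sum_apply, LinearMap.smul_apply,
    LinearMap.proj_apply]
  exact b.sum_repr (m j)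

theorem exists_isUniversal (K : Type) [Field K] [Algebra K A] [FiniteDimensional K A]
    {M : ModuleCat.{0} A} [Module.Finite A M] (hT : IsTorsionClass A (Fac A M)) :
    ∃ (P : ModuleCat.{0} A) (p : P), IsUniversal (Fac A M) p := by
  let _ : Module K M := Module.compHom M (algebraMap K A)
  have : IsScalarTower K A M := IsScalarTower.of_algebraMap_smul fun _ _ => rfl
  have : Module.Finite K M := Module.Finite.trans A M
  exact ⟨ModuleCat.of A (Fin _ → M), _, isUniversal_pi_basis K hT (Module.finBasis K M)⟩

theorem exists_fin_surjective {Y : Type} [AddCommGroup Y] [Module A Y]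
    {P : Type} [AddCommGroup P] [Module A P] (p : P) {n : ℕ} (s : Fin n → Y)
    (hs : Submodule.span A (Set.range s) = ⊤) (a : Fin n → P →ₗ[A] Y) (ha : ∀ i, a i p = s i) :
    ∀ y, ∃ c : Fin n → A, (∑ i, a i ∘ₗ LinearMap.proj i : (Fin n → P) →ₗ[A] Y)
      (fun i => c i • p) = y := by
  intro y
  have hy : y ∈ Submodule.span A (Set.range s) := hs ▸ Submodule.mem_top
  obtain ⟨c, rfl⟩ := (Submodule.mem_span_range_iff_exists_fun A).1 hy
  exact ⟨c, by simp [LinearMap.sum_apply, ha]⟩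

/-- Every member of `T` is a quotient, with kernel in `T`, of a direct sum of copies of `P`
and `P / A p`, where `p ∈ P` is universal. -/
theorem IsUniversal.exists_presentation [IsNoetherianRing A] {T : Set (ModuleCat.{0} A)}
    (hT : IsTorsionClass A T) {P : Type} [AddCommGroup P] [Module A P] {p : P}
    (hp : IsUniversal T p) {Y : Type} [AddCommGroup Y] [Module A Y]
    (hY : ModuleCat.of A Y ∈ T) :
    ∃ (m r : ℕ) (π : (Fin m → P) × (Fin r → P ⧸ Submodule.span A {p}) →ₗ[A] Y),
      Function.Surjective π ∧ ModuleCat.of A (LinearMap.ker π) ∈ T := by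
  have := hT.finite hY
  have := hT.finite hp.mem
  obtain ⟨m, s, hs⟩ := Module.Finite.exists_fin (R := A) (M := Y)
  choose a ha using fun i => hp.exists_map (ModuleCat.of A Y) hY (s i)
  let π₀ : (Fin m → P) →ₗ[A] Y := ∑ i, a i ∘ₗ LinearMap.proj i
  have hπ₀ : Function.Surjective π₀ := fun y => by
    obtain ⟨c, hc⟩ := exists_fin_surjective p s hs a ha y
    exact ⟨_, hc⟩
  obtain ⟨r, t, ht⟩ := Submodule.fg_iff_exists_fin_generating_family.1
    (IsNoetherian.noetherian (LinearMap.ker π₀))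
  choose f hf using fun j => hp.exists_map (ModuleCat.of A (Fin m → P)) (hT.pi hp.mem m) (t j)
  have htk : ∀ j, π₀ (t j) = 0 := fun j => by
    have : t j ∈ LinearMap.ker π₀ := ht ▸ Submodule.subset_span ⟨j, rfl⟩
    exact this
  have hle : ∀ j, Submodule.span A {p} ≤ LinearMap.ker (π₀ ∘ₗ f j) := fun j => by
    rw [Submodule.span_singleton_le_iff_mem, LinearMap.mem_ker]
    exact (congrArg π₀ (hf j)).trans (htk j)
  let q := (Submodule.span A {p}).mkQ
  let g : Fin r → (P ⧸ Submodule.span A {p}) →ₗ[A] Y := fun j =>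
    (Submodule.span A {p}).liftQ (π₀ ∘ₗ f j) (hle j)
  let G : (Fin r → P ⧸ Submodule.span A {p}) →ₗ[A] Y := ∑ j, g j ∘ₗ LinearMap.proj j
  let F : (Fin r → P) →ₗ[A] (Fin m → P) := ∑ j, f j ∘ₗ LinearMap.proj j
  let Q : (Fin r → P) →ₗ[A] (Fin r → P ⧸ Submodule.span A {p}) :=
    LinearMap.pi fun j => q ∘ₗ LinearMap.proj j
  have hGQ : ∀ z, G (Q z) = π₀ (F z) := fun z => by
    simp only [G, F, Q, LinearMap.sum_apply, LinearMap.comp_apply, LinearMap.proj_apply,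
      LinearMap.pi_apply, map_sum]
    rfl
  have hQ : Function.Surjective Q := fun c => by
    choose x hx using fun j => (Submodule.span A {p}).mkQ_surjective (c j)
    exact ⟨x, funext hx⟩
  refine ⟨m, r, π₀.coprod (-G), fun y => ?_, ?_⟩
  · obtain ⟨x, rfl⟩ := hπ₀ y
    exact ⟨(x, 0), by simp⟩
  have hker : LinearMap.ker (π₀.coprod (-G)) = LinearMap.range (F.prod Q) := by
    apply le_antisymm
    · rintro ⟨x, c⟩ hxc
      obtain ⟨z, rfl⟩ := hQ c
      have hx : π₀ (x - F z) = 0 := by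
        rw [map_sub, ← hGQ]
        simpa [sub_eq_add_neg] using hxc
      have hx' : x - F z ∈ Submodule.span A (Set.range t) := by rw [ht]; exact hx
      obtain ⟨d, hd⟩ := (Submodule.mem_span_range_iff_exists_fun A).1 hx'
      refine ⟨z + fun j => d j • p, Prod.ext ?_ ?_⟩
      · change F (z + fun j => d j • p) = x
        rw [map_add]
        have : F (fun j => d j • p) = x - F z := by
          rw [← hd]
          simp only [F, LinearMap.sum_apply, LinearMap.comp_apply, LinearMap.proj_apply, map_smul]
          exact Finset.sum_congr rfl fun j _ => congrArg (d j • ·) (hf j)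
        rw [this, add_sub_cancel]
      · change Q (z + fun j => d j • p) = Q z
        rw [map_add, add_eq_left]
        ext j
        simp only [Q, q, LinearMap.pi_apply, LinearMap.comp_apply, LinearMap.proj_apply, map_smul]
        have h0 : (Submodule.span A {p}).mkQ p = 0 := by
          simp
        rw [h0, smul_zero]
        rfl
    · rintro _ ⟨z, rfl⟩
      simp [hGQ]
  rw [hker]
  exact hT.range_mem (hT.pi hp.mem r) _

/-- A maximal torsion subclass of a functorially finite torsion class is functorially
finite. -/
theorem IsTorsionCover.exists_eq_Fac [IsArtinianRing A] {U T : Set (ModuleCat.{0} A)}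
    (h : IsTorsionCover U T) {P : Type} [AddCommGroup P] [Module A P] {p : P}
    (hp : IsUniversal T p) : ∃ M : ModuleCat.{0} A, Module.Finite A M ∧ U = Fac A M := by
  obtain ⟨B, hB⟩ := h.exists_label
  have := h.right.finite hp.mem
  obtain ⟨R, hR, hRmax, -⟩ := h.left.exists_radical h.nonempty P
  obtain ⟨R', hR', hRmax', -⟩ :=
    h.left.exists_radical h.nonempty (P ⧸ Submodule.span A {p})
  have hM := h.left.prod hR hR'
  refine ⟨ModuleCat.of A (R × R'), h.left.finite hM, le_antisymm ?_ (h.left.fac_subset hM)⟩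
  intro Y hY
  obtain ⟨m, r, π, hπ, hk⟩ := hp.exists_presentation h.right (Y := Y) (h.ssubset.1 hY)
  have hN : ModuleCat.of A ((Fin m → P) × (Fin r → P ⧸ Submodule.span A {p})) ∈ T :=
    h.right.prod (h.right.pi hp.mem m)
      (h.right.pi (h.right.of_surjective hp.mem _ (Submodule.mkQ_surjective _)) r)
  have := h.right.finite hN
  obtain ⟨S, hS, -, hfree⟩ := h.left.exists_radical h.nonempty
    ((Fin m → P) × (Fin r → P ⧸ Submodule.span A {p}))
  have hW : Subsingleton (Y ⧸ S.map π) := by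
    have hle : S ≤ (S.map π).comap π := Submodule.le_comap_map π S
    have hQ := h.right.of_surjective hN S.mkQ S.mkQ_surjective
    have := h.right.finite hQ
    refine h.subsingleton_of_surjective hB
      (h.left.of_surjective (X := Y) hY (S.map π).mkQ (Submodule.mkQ_surjective _))
      (Module.length A (_ ⧸ S)).toNat (ENat.natCast_toNat Module.length_ne_top).ge hQ hfree
      (S.mapQ (S.map π) π hle) ?_ ?_
    · intro w
      obtain ⟨y, rfl⟩ := Submodule.mkQ_surjective _ w
      obtain ⟨x, rfl⟩ := hπ y
      exact ⟨S.mkQ x, rfl⟩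
    · refine h.right.of_surjective hk
        ((S.mkQ ∘ₗ (LinearMap.ker π).subtype).codRestrict _ fun x => ?_) ?_
      · have : π x = 0 := x.2
        simp [this]
      · rintro ⟨w, hw⟩
        obtain ⟨x, rfl⟩ := S.mkQ_surjective w
        have hx : π x ∈ S.map π := by simpa using hw
        obtain ⟨s, hs, hsx⟩ := hx
        refine ⟨⟨x - s, by simp [hsx]⟩, Subtype.ext ?_⟩
        have h0 : S.mkQ s = 0 := by simpa using hs
        change S.mkQ (x - s) = S.mkQ x
        rw [map_sub, h0, sub_zero]
  have hSπ : S.map π = ⊤ := Submodule.Quotient.subsingleton_iff.1 hW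
  let F : (Fin m ⊕ Fin r → R × R') →ₗ[A] Y := π ∘ₗ LinearMap.prod
    (LinearMap.pi fun i => R.subtype ∘ₗ LinearMap.fst A R R' ∘ₗ LinearMap.proj (Sum.inl i))
    (LinearMap.pi fun j => R'.subtype ∘ₗ LinearMap.snd A R R' ∘ₗ LinearMap.proj (Sum.inr j))
  refine mem_Fac_of_fintype (M := ModuleCat.of A (R × R')) (X := Y) F fun y => ?_
  have hy : y ∈ S.map π := hSπ ▸ Submodule.mem_top
  obtain ⟨s, hs, rfl⟩ := hy
  have h1 : ∀ i, s.1 i ∈ R := fun i => hRmax _ (h.left.range_mem hS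
    (LinearMap.proj i ∘ₗ LinearMap.fst A _ _ ∘ₗ S.subtype)) ⟨⟨s, hs⟩, rfl⟩
  have h2 : ∀ j, s.2 j ∈ R' := fun j => hRmax' _ (h.left.range_mem hS
    (LinearMap.proj j ∘ₗ LinearMap.snd A _ _ ∘ₗ S.subtype)) ⟨⟨s, hs⟩, rfl⟩
  exact ⟨Sum.elim (fun i => (⟨s.1 i, h1 i⟩, 0)) (fun j => (0, ⟨s.2 j, h2 j⟩)), rfl⟩

/-! ### τ-rigid modules and bricks -/

theorem IsTauRigid.exists_lift {X : ModuleCat.{0} A} (hX : IsTauRigid A X) {E N : Type}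
    [AddCommGroup E] [Module A E] [AddCommGroup N] [Module A N] (g : E →ₗ[A] N)
    (hg : Function.Surjective g) (hk : ModuleCat.of A (LinearMap.ker g) ∈ Fac A X)
    (h : X →ₗ[A] N) : ∃ l : X →ₗ[A] E, g ∘ₗ l = h := by
  let D : Submodule A (E × X) := LinearMap.eqLocus (g ∘ₗ LinearMap.fst A E X)
    (h ∘ₗ LinearMap.snd A E X)
  let i : LinearMap.ker g →ₗ[A] D :=
    (LinearMap.inl A E X ∘ₗ (LinearMap.ker g).subtype).codRestrict D fun x => by
      have : g x = 0 := x.2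
      simp [D, LinearMap.mem_eqLocus, this]
  obtain ⟨s, hs⟩ := hX _ hk (ModuleCat.of A D) i (LinearMap.snd A E X ∘ₗ D.subtype)
    (fun x y hxy => Subtype.ext (congrArg (fun d : D => d.1.1) hxy))
    (fun x => by
      obtain ⟨e, he⟩ := hg (h x)
      exact ⟨⟨(e, x), he⟩, rfl⟩)
    (by
      ext ⟨⟨e, x⟩, hd⟩
      have hd' : g e = h x := hd
      constructor
      · rintro ⟨z, hz⟩
        exact (congrArg (fun d : D => d.1.2) hz).symm
      · intro hx
        have hx' : x = 0 := hx
        refine ⟨⟨e, ?_⟩, Subtype.ext (Prod.ext rfl hx'.symm)⟩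
        rw [LinearMap.mem_ker, hd', hx', map_zero])
  refine ⟨LinearMap.fst A E X ∘ₗ D.subtype ∘ₗ s, ?_⟩
  ext x
  have h1 : g (s x).1.1 = h (s x).1.2 := (s x).2
  have h2 : (s x).1.2 = x := LinearMap.congr_fun hs x
  rw [h2] at h1
  exact h1

theorem IsTauRigid.isTorsionClass_Fac {X : ModuleCat.{0} A} [Module.Finite A X]
    (hX : IsTauRigid A X) : IsTorsionClass A (Fac A X) := by
  refine ⟨fun M hM => finite_of_mem_Fac hM,
    fun M hM N ⟨e⟩ => Fac_of_surjective (X := M) hM e.toLinearMap e.surjective,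
    fun M hM N ⟨f, hf⟩ => Fac_of_surjective (X := M) hM f hf, ?_⟩
  rintro L E N i g hi hg hex ⟨k, a, ha⟩ ⟨n, b, hb⟩
  have hk : ModuleCat.of A (LinearMap.ker g) ∈ Fac A X := by
    rw [← hex]
    exact ⟨k, i.rangeRestrict ∘ₗ a, i.surjective_rangeRestrict.comp ha⟩
  choose l hl using fun j : Fin n =>
    hX.exists_lift g hg hk (b ∘ₗ LinearMap.single A (fun _ => X) j)
  let l' : (Fin n → X) →ₗ[A] E := ∑ j, l j ∘ₗ LinearMap.proj j
  have hl' : ∀ x, g (l' x) = b x := fun x => by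
    have : ∀ j, g (l j (x j)) = b (Pi.single j (x j)) := fun j => LinearMap.congr_fun (hl j) (x j)
    simp only [l', LinearMap.sum_apply, LinearMap.comp_apply, LinearMap.proj_apply, map_sum, this]
    rw [← map_sum, Finset.univ_sum_single]
  let F : (Fin k ⊕ Fin n → X) →ₗ[A] E :=
    i ∘ₗ a ∘ₗ LinearMap.funLeft A X Sum.inl + l' ∘ₗ LinearMap.funLeft A X Sum.inr
  refine mem_Fac_of_fintype (X := E) F fun e => ?_
  obtain ⟨x, hx⟩ := hb (g e)
  have he : e - l' x ∈ LinearMap.range i := by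
    rw [hex, LinearMap.mem_ker, map_sub, hl', hx, sub_self]
  obtain ⟨y, hy⟩ := he
  obtain ⟨z, rfl⟩ := ha y
  refine ⟨Sum.elim z x, ?_⟩
  change i (a z) + l' x = e
  rw [hy, sub_add_cancel]

theorem IsTauRigid.of_retract {X Y : ModuleCat.{0} A} (hX : IsTauRigid A X)
    (i : Y →ₗ[A] X) (r : X →ₗ[A] Y) (hri : r ∘ₗ i = LinearMap.id) : IsTauRigid A Y := by
  have hr : Function.Surjective r := fun y => ⟨i y, LinearMap.congr_fun hri y⟩
  have hY : Y ∈ Fac A X := Fac_of_surjective (X := X) (self_mem_Fac X) r hr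
  intro Z hZ E f g hf hg hex
  have hk : ModuleCat.of A (LinearMap.ker g) ∈ Fac A X := by
    rw [← hex]
    exact Fac_of_surjective (X := Z) (Fac_trans hY hZ) f.rangeRestrict
      f.surjective_rangeRestrict
  obtain ⟨l, hl⟩ := hX.exists_lift g hg hk r
  exact ⟨l ∘ₗ i, by rw [← LinearMap.comp_assoc, hl, hri]⟩

/-- A functorially finite torsion class is generated by a τ-rigid module. -/
theorem exists_isTauRigid_eq_Fac (K : Type) [Field K] [Algebra K A] [FiniteDimensional K A]
    {M : ModuleCat.{0} A} [Module.Finite A M] (hT : IsTorsionClass A (Fac A M)) :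
    ∃ P : ModuleCat.{0} A, Module.Finite A P ∧ IsTauRigid A P ∧ Fac A P = Fac A M := by
  have : IsArtinianRing A := IsArtinianRing.of_finite K A
  obtain ⟨⟨P, p⟩, hp, hmin⟩ := WellFounded.has_min
    (InvImage.wf (fun x : Σ P : ModuleCat.{0} A, P => Module.length A x.1) wellFounded_lt)
    {x | IsUniversal (Fac A M) x.2} (by
      obtain ⟨P, p, hp⟩ := exists_isUniversal K hT
      exact ⟨⟨P, p⟩, hp⟩)
  have hp : IsUniversal (Fac A M) p := hp
  have := hT.finite hp.mem
  refine ⟨P, this, ?_, le_antisymm (hT.fac_subset hp.mem) fun Y hY => ?_⟩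
  · intro X hX E f g hf hg hex
    have hX' : X ∈ Fac A M := Fac_trans hp.mem hX
    have hE : E ∈ Fac A M := hT.2.2.2 X E P f g hf hg hex hX' hp.mem
    obtain ⟨e, he⟩ := hg p
    obtain ⟨s, hs⟩ := hp.exists_map E hE e
    have hpr : p ∈ LinearMap.range (g ∘ₗ s) := ⟨p, by rw [LinearMap.comp_apply, hs, he]⟩
    have huniv : IsUniversal (Fac A M) (⟨p, hpr⟩ : LinearMap.range (g ∘ₗ s)) :=
      ⟨hT.range_mem hp.mem (g ∘ₗ s), fun Y hY y => by
        obtain ⟨φ, hφ⟩ := hp.exists_map Y hY y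
        exact ⟨φ ∘ₗ Submodule.subtype _, hφ⟩⟩
    have htop : LinearMap.range (g ∘ₗ s) = ⊤ := by
      by_contra hne
      exact hmin ⟨ModuleCat.of A (LinearMap.range (g ∘ₗ s)), ⟨p, hpr⟩⟩ huniv
        (Submodule.length_lt hne)
    have hbij := IsNoetherian.bijective_of_surjective_endomorphism _
      (LinearMap.range_eq_top.1 htop)
    let ε := LinearEquiv.ofBijective (g ∘ₗ s) hbij
    refine ⟨s ∘ₗ ε.symm.toLinearMap, ?_⟩
    ext x
    exact ε.apply_symm_apply x
  · have := hT.1 Y hY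
    obtain ⟨n, s, hs⟩ := Module.Finite.exists_fin (R := A) (M := Y)
    choose a ha using fun i => hp.exists_map Y hY (s i)
    refine ⟨n, ∑ i, a i ∘ₗ LinearMap.proj i, fun y => ?_⟩
    obtain ⟨c, hc⟩ := exists_fin_surjective p s hs a ha y
    exact ⟨_, hc⟩

/-- An endomorphism of an indecomposable module of finite length is bijective or nilpotent. -/
theorem bijective_or_isNilpotent {X : Type} [AddCommGroup X] [Module A X] [IsArtinian A X]
    [IsNoetherian A X] (hind : ∀ p q : Submodule A X, IsCompl p q → p = ⊥ ∨ q = ⊥)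
    (f : Module.End A X) : Function.Bijective f ∨ IsNilpotent f := by
  obtain ⟨n, hn⟩ := f.eventually_isCompl_ker_pow_range_pow.exists_forall_of_atTop
  obtain h | h := hind _ _ (hn (n + 1) n.le_succ)
  · left
    have hinj : Function.Injective f := by
      rw [← LinearMap.ker_eq_bot, eq_bot_iff, ← h, pow_succ]
      exact LinearMap.ker_le_ker_comp f (f ^ n)
    exact IsArtinian.bijective_of_injective_endomorphism f hinj
  · exact Or.inr ⟨n + 1, LinearMap.range_eq_bot.1 h⟩

theorem mem_jacobson_of_not_bijective {X : Type} [AddCommGroup X] [Module A X] [IsArtinian A X]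
    [IsNoetherian A X] (hind : ∀ p q : Submodule A X, IsCompl p q → p = ⊥ ∨ q = ⊥)
    {f : Module.End A X} (hf : ¬ Function.Bijective f) : f ∈ Ring.jacobson (Module.End A X) := by
  rw [Ring.jacobson_eq_sInf_isMaximal, Submodule.mem_sInf]
  intro m hm
  have hm : Ideal.IsMaximal m := hm
  by_contra hfm
  obtain ⟨g, hg⟩ := hm.exists_inv hfm
  obtain ⟨j, hj, hgj⟩ := hg
  have hnil : IsNilpotent (g * f) := by
    refine (bijective_or_isNilpotent hind (g * f)).resolve_left fun hb => hf ?_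
    exact IsArtinian.bijective_of_injective_endomorphism f
      (Function.Injective.of_comp (f := g) hb.1)
  have hu : IsUnit j := by
    rw [← eq_sub_iff_add_eq'] at hgj
    exact hgj ▸ hnil.isUnit_one_sub
  exact hm.ne_top (Ideal.eq_top_of_isUnit_mem m hj hu)

theorem exists_ne_zero_comp_eq_zero (K : Type) [Field K] [Algebra K A] [FiniteDimensional K A]
    {X F : Type} [AddCommGroup X] [Module A X] [Module.Finite A X] [AddCommGroup F] [Module A F]
    (hind : ∀ p q : Submodule A X, IsCompl p q → p = ⊥ ∨ q = ⊥) (h : X →ₗ[A] F) (hh : h ≠ 0) :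
    ∃ h' : X →ₗ[A] F, h' ≠ 0 ∧ ∀ f : X →ₗ[A] X, ¬ Function.Bijective f → h' ∘ₗ f = 0 := by
  let _ : Module K X := Module.compHom X (algebraMap K A)
  have : IsScalarTower K A X := IsScalarTower.of_algebraMap_smul fun _ _ => rfl
  have : Module.Finite K X := Module.Finite.trans A X
  have : IsArtinianRing A := IsArtinianRing.of_finite K A
  have : IsArtinianRing (Module.End A X) := IsArtinianRing.of_finite K _
  obtain ⟨n, hn⟩ := IsSemiprimaryRing.isNilpotent (R := Module.End A X)
  by_contra! hcon
  have key : ∀ k, ∃ g ∈ Ring.jacobson (Module.End A X) ^ k, h ∘ₗ g ≠ 0 := by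
    intro k
    induction k with
    | zero =>
      refine ⟨1, ?_, hh⟩
      rw [Submodule.pow_zero, Ideal.one_eq_top]
      exact Submodule.mem_top
    | succ k ih =>
      obtain ⟨g, hg, hhg⟩ := ih
      obtain ⟨f, hf, hgf⟩ := hcon _ hhg
      refine ⟨g * f, ?_, hgf⟩
      rw [Submodule.pow_succ]
      exact Ideal.mul_mem_mul hg (mem_jacobson_of_not_bijective hind hf)
  obtain ⟨g, hg, hhg⟩ := key n
  rw [hn] at hg
  have : g = 0 := hg
  exact hhg (by rw [this, LinearMap.comp_zero])

theorem isTorsionClass_finite : IsTorsionClass A {M : ModuleCat.{0} A | Module.Finite A M} := by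
  refine ⟨fun M hM => hM, fun M hM N ⟨e⟩ => ?_, fun M hM N ⟨f, hf⟩ => ?_,
    fun L E N f g hf hg hex hL hN => ?_⟩
  · have : Module.Finite A M := hM
    exact Module.Finite.equiv e
  · have : Module.Finite A M := hM
    exact Module.Finite.of_surjective f hf
  · have : Module.Finite A L := hL
    have : Module.Finite A N := hN
    have : Module.Finite A (LinearMap.ker g) := by
      rw [← hex]
      infer_instance
    have : Module.Finite A (E ⧸ LinearMap.ker g) :=
      Module.Finite.equiv (g.quotKerEquivOfSurjective hg).symm
    exact Module.Finite.of_submodule_quotient (LinearMap.ker g)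

theorem isTorsionClass_torsGen {N : ModuleCat.{0} A} (hN : Module.Finite A N) :
    IsTorsionClass A (torsGen A N) := by
  refine ⟨fun M hM => hM _ ⟨isTorsionClass_finite, hN⟩,
    fun M hM X e T hT => hT.1.2.1 M (hM T hT) X e,
    fun M hM X f T hT => hT.1.2.2.1 M (hM T hT) X f,
    fun L E X f g hf hg hex hL hX T hT => hT.1.2.2.2 L E X f g hf hg hex (hL T hT) (hX T hT)⟩

theorem self_mem_torsGen (N : ModuleCat.{0} A) : N ∈ torsGen A N := fun _ hT => hT.2

theorem torsGen_subset {T : Set (ModuleCat.{0} A)} (hT : IsTorsionClass A T)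
    {N : ModuleCat.{0} A} (hN : N ∈ T) : torsGen A N ⊆ T := fun _ hM => hM T ⟨hT, hN⟩

/-- For an indecomposable τ-rigid module `X` the quotient of `X` by its radical over its
endomorphism ring is a brick generating the torsion class `Fac X`. -/
theorem IsTauRigid.exists_brick (K : Type) [Field K] [Algebra K A] [FiniteDimensional K A]
    {X : ModuleCat.{0} A} [Module.Finite A X] [Nontrivial X] (hX : IsTauRigid A X)
    (hind : ∀ p q : Submodule A X, IsCompl p q → p = ⊥ ∨ q = ⊥) :
    ∃ C : ModuleCat.{0} A, Module.Finite A C ∧ IsBrick A C ∧ torsGen A C = Fac A X := by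
  have : IsArtinianRing A := IsArtinianRing.of_finite K A
  have hT := hX.isTorsionClass_Fac
  have hne : (Fac A X).Nonempty := ⟨X, self_mem_Fac X⟩
  let R : Submodule A X :=
    ⨆ f : {f : X →ₗ[A] X // ¬ Function.Bijective f}, LinearMap.range f.1
  have hfR : ∀ f : X →ₗ[A] X, ¬ Function.Bijective f → R.mkQ ∘ₗ f = 0 := fun f hf => by
    ext x
    have : f x ∈ R := le_iSup (fun f : {f : X →ₗ[A] X // ¬ Function.Bijective f} =>
      LinearMap.range f.1) ⟨f, hf⟩ ⟨x, rfl⟩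
    simpa using this
  have hR : ModuleCat.of A R ∈ Fac A X :=
    hT.iSup_mem hne _ fun f => hT.range_mem (self_mem_Fac X) f.1
  have hker : ∀ {F : Type} [AddCommGroup F] [Module A F] (h : X →ₗ[A] F),
      (∀ f : X →ₗ[A] X, ¬ Function.Bijective f → h ∘ₗ f = 0) → R ≤ LinearMap.ker h := by
    intro F _ _ h hh
    refine iSup_le fun f => ?_
    rintro _ ⟨x, rfl⟩
    exact LinearMap.congr_fun (hh f.1 f.2) x
  have hRtop : R ≠ ⊤ := by
    intro htop
    obtain ⟨x, hx⟩ := exists_ne (0 : X)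
    obtain ⟨h, h0, hh⟩ := exists_ne_zero_comp_eq_zero K hind (LinearMap.id : X →ₗ[A] X)
      fun h0 => hx (LinearMap.congr_fun h0 x)
    have := hker h hh
    rw [htop, top_le_iff] at this
    exact h0 (LinearMap.ker_eq_top.1 this)
  have hCX : ModuleCat.of A (X ⧸ R) ∈ Fac A X :=
    hT.of_surjective (self_mem_Fac X) R.mkQ R.mkQ_surjective
  have hCfin : Module.Finite A (X ⧸ R) := hT.finite hCX
  refine ⟨ModuleCat.of A (X ⧸ R), hCfin,
    ⟨Submodule.Quotient.nontrivial_iff.2 hRtop, fun φ hφ => ?_⟩,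
    le_antisymm (torsGen_subset hT hCX) ?_⟩
  · change (X ⧸ R) →ₗ[A] (X ⧸ R) at φ
    obtain ⟨f, hf⟩ := hX.exists_lift R.mkQ R.mkQ_surjective (by rwa [Submodule.ker_mkQ])
      (φ ∘ₗ R.mkQ)
    by_cases hb : Function.Bijective f
    · have hs : Function.Surjective (φ ∘ₗ R.mkQ) := by
        rw [← hf]
        exact R.mkQ_surjective.comp hb.2
      exact IsNoetherian.bijective_of_surjective_endomorphism φ
        (Function.Surjective.of_comp hs)
    · refine absurd ?_ hφ
      rw [hfR f hb] at hf
      ext x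
      exact (LinearMap.congr_fun hf x).symm
  · have hC := isTorsionClass_torsGen (N := ModuleCat.of A (X ⧸ R)) hCfin
    refine hC.fac_subset ?_
    obtain ⟨S, hS, -, hfree⟩ := hC.exists_radical ⟨_, self_mem_torsGen _⟩ X
    by_cases htop : S = ⊤
    · subst htop
      exact hC.of_equiv hS Submodule.topEquiv
    · have hS0 : S.mkQ ≠ 0 := by
        intro h0
        apply htop
        rw [← S.ker_mkQ, h0, LinearMap.ker_zero]
      obtain ⟨h, h0, hh⟩ := exists_ne_zero_comp_eq_zero K hind S.mkQ hS0
      refine absurd ?_ h0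
      have := hfree.eq_zero (self_mem_torsGen (ModuleCat.of A (X ⧸ R))) (R.liftQ h (hker h hh))
      ext x
      exact LinearMap.congr_fun this (R.mkQ x)

/-- A torsion class containing every left finite brick in `Fac X`, where `X` is τ-rigid,
contains `X`. -/
theorem IsTauRigid.mem_of_bricks (K : Type) [Field K] [Algebra K A] [FiniteDimensional K A]
    {V : Set (ModuleCat.{0} A)} (hV : IsTorsionClass A V) (hne : V.Nonempty) (n : ℕ) :
    ∀ X : ModuleCat.{0} A, Module.Finite A X → IsTauRigid A X → Module.length A X ≤ n →
    (∀ B ∈ Fac A X, Module.Finite A B → IsBrick A B → LeftFinite A B → B ∈ V) → X ∈ V := by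
  have : IsArtinianRing A := IsArtinianRing.of_finite K A
  induction n with
  | zero =>
    intro X _ _ hlen _
    have : Subsingleton X := Module.length_eq_zero_iff.1 (by simpa using hlen)
    exact hV.of_subsingleton (X := X) hne
  | succ n ih =>
    intro X _ hX hlen hB
    have hT := hX.isTorsionClass_Fac
    by_cases hind : ∀ p q : Submodule A X, IsCompl p q → p = ⊥ ∨ q = ⊥
    · cases subsingleton_or_nontrivial X with
      | inl _ => exact hV.of_subsingleton (X := X) hne
      | inr _ =>
        obtain ⟨C, hC, hCb, hCX⟩ := hX.exists_brick K hind
        have hCV := hB C (hCX ▸ self_mem_torsGen C) hC hCb ⟨X, inferInstance, hCX⟩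
        exact torsGen_subset hV hCV (hCX ▸ self_mem_Fac X)
    · push Not at hind
      obtain ⟨p, q, hpq, hp, hq⟩ := hind
      have key : ∀ p q : Submodule A X, IsCompl p q → q ≠ ⊥ → ModuleCat.of A p ∈ V := by
        intro p q hpq hq
        have hpX : ModuleCat.of A p ∈ Fac A X :=
          hT.of_surjective (self_mem_Fac X) (p.projectionOnto q hpq)
            (Submodule.projectionOnto_surjective hpq)
        have hptop : p ≠ ⊤ := by
          rintro rfl
          exact hq (by simpa using hpq.inf_eq_bot)
        have hlt : Module.length A p < Module.length A X := Submodule.length_lt hptop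
        refine ih (ModuleCat.of A p) (hT.finite hpX)
          (hX.of_retract (Y := ModuleCat.of A p) p.subtype (p.projectionOnto q hpq) ?_) ?_
          fun B hBp => hB B (Fac_trans hpX hBp)
        · ext x
          simp
        · have := hlt.trans_le hlen
          rw [Nat.cast_add, Nat.cast_one] at this
          exact Order.le_of_lt_add_one this
      have := hV.sup (key p q hpq hq) (key q p hpq.symm hp)
      rw [hpq.sup_eq_top] at this
      exact hV.of_equiv this Submodule.topEquiv

/-! ### Counting torsion classes and bricks -/

/-- Functorially finite torsion classes are determined by their left finite bricks. -/
theorem IsTorsionClass.Fac_subset_of_bricks (K : Type) [Field K] [Algebra K A]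
    [FiniteDimensional K A] {M : ModuleCat.{0} A} [Module.Finite A M]
    (hT : IsTorsionClass A (Fac A M)) {V : Set (ModuleCat.{0} A)} (hV : IsTorsionClass A V)
    (hne : V.Nonempty)
    (hB : ∀ B ∈ Fac A M, Module.Finite A B → IsBrick A B → LeftFinite A B → B ∈ V) :
    Fac A M ⊆ V := by
  have : IsArtinianRing A := IsArtinianRing.of_finite K A
  obtain ⟨P, hPf, hP, hPM⟩ := exists_isTauRigid_eq_Fac K hT
  rw [← hPM] at hB ⊢
  exact hV.fac_subset (hP.mem_of_bricks K hV hne (Module.length A P).toNat P hPf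
    (ENat.natCast_toNat Module.length_ne_top).ge hB)

theorem finite_functoriallyFinite (K : Type) [Field K] [Algebra K A] [FiniteDimensional K A]
    (hfin : Finite (Quotient (isoSetoid A
      (fun M => Module.Finite A M ∧ IsBrick A M ∧ LeftFinite A M)))) :
    {T | IsTorsionClass A T ∧ ∃ M : ModuleCat.{0} A, Module.Finite A M ∧ T = Fac A M}.Finite := by
  let φ : Set (ModuleCat.{0} A) → Set (Quotient (isoSetoid A
      (fun M => Module.Finite A M ∧ IsBrick A M ∧ LeftFinite A M))) :=
    fun T => {q | q.out.1 ∈ T}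
  have key : ∀ T V, IsTorsionClass A T → IsTorsionClass A V →
      (∃ M : ModuleCat.{0} A, Module.Finite A M ∧ T = Fac A M) → V.Nonempty →
      φ T ⊆ φ V → T ⊆ V := by
    rintro _ V hT hV ⟨M, hM, rfl⟩ hne hφ
    refine hT.Fac_subset_of_bricks K hV hne fun B hBM hBf hBb hBl => ?_
    let q : Quotient (isoSetoid A
      (fun M => Module.Finite A M ∧ IsBrick A M ∧ LeftFinite A M)) :=
        Quotient.mk _ ⟨B, hBf, hBb, hBl⟩
    obtain ⟨e⟩ : Nonempty (q.out.1 ≃ₗ[A] B) := Quotient.mk_out (s := isoSetoid A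
      (fun M => Module.Finite A M ∧ IsBrick A M ∧ LeftFinite A M)) ⟨B, hBf, hBb, hBl⟩
    have hq : q ∈ φ (Fac A M) := hT.2.1 B hBM _ ⟨e.symm⟩
    exact hV.2.1 _ (hφ hq) B ⟨e⟩
  refine Set.Finite.of_finite_image (f := φ) (Set.toFinite _) ?_
  rintro T ⟨hT, hTM⟩ V ⟨hV, hVM⟩ hTV
  have hne : ∀ T : Set (ModuleCat.{0} A),
      (∃ M : ModuleCat.{0} A, Module.Finite A M ∧ T = Fac A M) → T.Nonempty := by
    rintro _ ⟨M, -, rfl⟩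
    exact ⟨M, self_mem_Fac M⟩
  exact le_antisymm (key T V hT hV hTM (hne V hVM) hTV.le)
    (key V T hV hT hVM (hne T hTM) hTV.ge)

theorem IsTorsionClass.sUnion {c : Set (Set (ModuleCat.{0} A))} (hc : IsChain (· ⊆ ·) c)
    (h : ∀ V ∈ c, IsTorsionClass A V) : IsTorsionClass A (⋃₀ c) := by
  refine ⟨?_, ?_, ?_, ?_⟩
  · rintro M ⟨V, hV, hM⟩
    exact (h V hV).1 M hM
  · rintro M ⟨V, hV, hM⟩ N e
    exact ⟨V, hV, (h V hV).2.1 M hM N e⟩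
  · rintro M ⟨V, hV, hM⟩ N f
    exact ⟨V, hV, (h V hV).2.2.1 M hM N f⟩
  · rintro L E N f g hf hg hex ⟨V, hV, hL⟩ ⟨W, hW, hN⟩
    obtain hVW | hWV := hc.total hV hW
    · exact ⟨W, hW, (h W hW).2.2.2 L E N f g hf hg hex (hVW hL) hN⟩
    · exact ⟨V, hV, (h V hV).2.2.2 L E N f g hf hg hex hL (hWV hN)⟩

/-- Below a functorially finite torsion class there are enough maximal torsion subclasses. -/
theorem IsTorsionClass.exists_isTorsionCover {M : ModuleCat.{0} A}
    (hT : IsTorsionClass A (Fac A M)) {T' : Set (ModuleCat.{0} A)} (hT' : IsTorsionClass A T')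
    (hne : T'.Nonempty) (hlt : T' ⊂ Fac A M) :
    ∃ U, T' ⊆ U ∧ IsTorsionCover U (Fac A M) := by
  have hmem : ∀ V, IsTorsionClass A V → M ∈ V → Fac A M ⊆ V := fun V hV => hV.fac_subset
  obtain ⟨U, hTU, hU⟩ := zorn_subset_nonempty
    {V | IsTorsionClass A V ∧ V ⊆ Fac A M ∧ M ∉ V} (fun c hc hchain _ => by
      refine ⟨⋃₀ c, ⟨IsTorsionClass.sUnion hchain fun V hV => (hc hV).1,
        Set.sUnion_subset fun V hV => (hc hV).2.1, ?_⟩, fun V hV => Set.subset_sUnion_of_mem hV⟩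
      rintro ⟨V, hV, hMV⟩
      exact (hc hV).2.2 hMV) T' ⟨hT', hlt.1, fun h => hlt.2 (hmem T' hT' h)⟩
  obtain ⟨hUt, hUM, hMU⟩ := hU.prop
  refine ⟨U, hTU, hUt, hT, hne.mono hTU, ⟨hUM, fun h => hMU (h (self_mem_Fac M))⟩,
    fun V hV hUV hVM => ?_⟩
  by_contra hVne
  exact hUV.2 (hU.le_of_ge ⟨hV, hVM, fun h => hVne (hVM.antisymm (hmem V hV h))⟩ hUV.1)

theorem finite_torsionClasses (K : Type) [Field K] [Algebra K A] [FiniteDimensional K A]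
    (hfin : {T | IsTorsionClass A T ∧
      ∃ M : ModuleCat.{0} A, Module.Finite A M ∧ T = Fac A M}.Finite) :
    {T : Set (ModuleCat.{0} A) | IsTorsionClass A T}.Finite := by
  have : IsArtinianRing A := IsArtinianRing.of_finite K A
  refine (hfin.insert ∅).subset fun T' hT' => ?_
  have hT' : IsTorsionClass A T' := hT'
  obtain rfl | hne := T'.eq_empty_or_nonempty
  · exact Set.mem_insert _ _
  refine Set.mem_insert_of_mem _ ?_
  have hreg : {M : ModuleCat.{0} A | Module.Finite A M} = Fac A (ModuleCat.of A A) := by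
    ext X
    constructor
    · intro hX
      have : Module.Finite A X := hX
      exact Module.Finite.exists_fin' A X
    · exact fun hX => finite_of_mem_Fac hX
  obtain ⟨T, ⟨⟨hT, M, hM, rfl⟩, hT'T⟩, hmin⟩ := Set.Finite.exists_minimal
    (s := {T | (IsTorsionClass A T ∧
      ∃ M : ModuleCat.{0} A, Module.Finite A M ∧ T = Fac A M) ∧ T' ⊆ T})
    (hfin.subset fun T hT => hT.1)
    ⟨_, ⟨isTorsionClass_finite, ModuleCat.of A A, inferInstanceAs (Module.Finite A A), hreg⟩,
      fun M hM => hT'.1 M hM⟩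
  by_cases heq : T' = Fac A M
  · exact ⟨hT', M, hM, heq⟩
  obtain ⟨U, hTU, hU⟩ := hT.exists_isTorsionCover hT' hne (hT'T.ssubset_of_ne heq)
  obtain ⟨P, p, hp⟩ := exists_isUniversal K hT
  exact absurd (hmin ⟨⟨hU.left, hU.exists_eq_Fac hp⟩, hTU⟩ hU.ssubset.1) hU.ssubset.2

/-- A member of the torsion class generated by a brick `B` maps to `B` by zero or onto. -/
theorem IsBrick.eq_zero_or_surjective {B X : ModuleCat.{0} A} (hBf : Module.Finite A B)
    (hB : IsBrick A B) (hX : X ∈ torsGen A B) (f : X →ₗ[A] B) :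
    f = 0 ∨ Function.Surjective f := by
  have hT := isTorsionClass_finite (A := A)
  refine (hX {Y | Module.Finite A Y ∧ ∀ f : Y →ₗ[A] B, f = 0 ∨ Function.Surjective f}
    ⟨⟨fun M hM => hM.1, ?_, ?_, ?_⟩, hBf, fun f => ?_⟩).2 f
  · rintro M ⟨hM, h⟩ N ⟨e⟩
    refine ⟨hT.2.1 M hM N ⟨e⟩, fun f => ?_⟩
    obtain h0 | hs := h (f ∘ₗ e.toLinearMap)
    · left
      ext x
      simpa using LinearMap.congr_fun h0 (e.symm x)
    · exact Or.inr (Function.Surjective.of_comp (f := f) (g := e) hs)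
  · rintro M ⟨hM, h⟩ N ⟨g, hg⟩
    refine ⟨hT.2.2.1 M hM N ⟨g, hg⟩, fun f => ?_⟩
    obtain h0 | hs := h (f ∘ₗ g)
    · left
      ext x
      obtain ⟨y, rfl⟩ := hg x
      exact LinearMap.congr_fun h0 y
    · exact Or.inr (Function.Surjective.of_comp (f := f) (g := g) hs)
  · rintro L E N i g hi hg hex ⟨hL, h⟩ ⟨hN, h'⟩
    refine ⟨hT.2.2.2 L E N i g hi hg hex hL hN, fun f => ?_⟩
    obtain h0 | hs := h (f ∘ₗ i)
    · have hk : LinearMap.ker g ≤ LinearMap.ker f := by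
        rw [← hex]
        rintro _ ⟨x, rfl⟩
        exact LinearMap.congr_fun h0 x
      let f' : N →ₗ[A] B := (LinearMap.ker g).liftQ f hk ∘ₗ
        (g.quotKerEquivOfSurjective hg).symm.toLinearMap
      have hf' : ∀ x, f' (g x) = f x := fun x => by
        have : (g.quotKerEquivOfSurjective hg).symm (g x) = (LinearMap.ker g).mkQ x := by
          rw [LinearEquiv.symm_apply_eq]
          rfl
        simp only [f', LinearMap.comp_apply, LinearEquiv.coe_coe, this]
        rfl
      obtain h0' | hs' := h' f'
      · left
        ext x
        rw [← hf', h0']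
        rfl
      · refine Or.inr fun b => ?_
        obtain ⟨n, rfl⟩ := hs' b
        obtain ⟨x, rfl⟩ := hg n
        exact ⟨x, (hf' x).symm⟩
    · exact Or.inr (Function.Surjective.of_comp (f := f) (g := i) hs)
  · by_cases h0 : f = 0
    · exact Or.inl h0
    · exact Or.inr (hB.2 f h0).2

theorem IsBrick.exists_surjective {B B' : ModuleCat.{0} A} (hBf : Module.Finite A B)
    (hBf' : Module.Finite A B') (hB : IsBrick A B) (h : torsGen A B = torsGen A B') :
    ∃ f : B' →ₗ[A] B, Function.Surjective f := by
  have hf : ∃ f : B' →ₗ[A] B, f ≠ 0 := by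
    by_contra! hcon
    have hB0 := torsGen_subset (isTorsionClass_finite.inter_perp B) (N := B') ⟨hBf', hcon⟩
      (h ▸ self_mem_torsGen B)
    have : Nontrivial B := hB.1
    obtain ⟨x, hx⟩ := exists_ne (0 : B)
    exact hx (LinearMap.congr_fun (hB0.2 LinearMap.id) x)
  obtain ⟨f, hf⟩ := hf
  exact ⟨f, (hB.eq_zero_or_surjective hBf (h ▸ self_mem_torsGen B') f).resolve_left hf⟩

/-- Bricks are determined by the torsion classes they generate. -/
theorem IsBrick.nonempty_linearEquiv [IsNoetherianRing A] {B B' : ModuleCat.{0} A}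
    (hBf : Module.Finite A B) (hBf' : Module.Finite A B') (hB : IsBrick A B)
    (hB' : IsBrick A B') (h : torsGen A B = torsGen A B') : Nonempty (B ≃ₗ[A] B') := by
  obtain ⟨f, hf⟩ := hB'.exists_surjective hBf' hBf h.symm
  obtain ⟨g, hg⟩ := hB.exists_surjective hBf hBf' h
  have hgf := IsNoetherian.bijective_of_surjective_endomorphism (g ∘ₗ f) (hg.comp hf)
  exact ⟨LinearEquiv.ofBijective f ⟨Function.Injective.of_comp (f := g) hgf.1, hf⟩⟩

theorem finite_bricks [IsNoetherianRing A]
    (hfin : {T : Set (ModuleCat.{0} A) | IsTorsionClass A T}.Finite) :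
    Finite (Quotient (isoSetoid A (fun M => Module.Finite A M ∧ IsBrick A M))) := by
  have := hfin.to_subtype
  refine Finite.of_injective (β := {T : Set (ModuleCat.{0} A) | IsTorsionClass A T})
    (fun q => ⟨torsGen A q.out.1, isTorsionClass_torsGen q.out.2.1⟩) fun q q' h => ?_
  have h : torsGen A q.out.1 = torsGen A q'.out.1 := congrArg Subtype.val h
  rw [← Quotient.out_equiv_out]
  exact IsBrick.nonempty_linearEquiv q.out.2.1 q'.out.2.1 q.out.2.2 q'.out.2.2 h

theorem finite_isoClasses_of_imp {P Q : ModuleCat.{0} A → Prop} (hPQ : ∀ M, P M → Q M)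
    (hfin : Finite (Quotient (isoSetoid A Q))) : Finite (Quotient (isoSetoid A P)) := by
  refine Finite.of_injective (β := Quotient (isoSetoid A Q))
    (fun q => Quotient.mk _ ⟨q.out.1, hPQ _ q.out.2⟩) fun q q' h => ?_
  rw [← Quotient.out_equiv_out]
  have hr := Quotient.exact (s := isoSetoid A Q) (a := ⟨q.out.1, hPQ _ q.out.2⟩)
    (b := ⟨q'.out.1, hPQ _ q'.out.2⟩) h
  exact hr

end TorsionClasses

/-- the following are equivalent: (a) `mod A` has only finitely many torsion
classes; (b) there are only finitely many bricks up to isomorphism; (c) there are only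
finitely many left finite bricks up to isomorphism. -/
theorem tauTiltingFinite_tfae (A : Type) [Ring A]
    (K : Type) [Field K] [Algebra K A] [FiniteDimensional K A]
 :
    List.TFAE
      [ {T : Set (ModuleCat.{0} A) | IsTorsionClass A T}.Finite,
        Finite (Quotient (isoSetoid A (fun M => Module.Finite A M ∧ IsBrick A M))),
        Finite (Quotient (isoSetoid A
          (fun M => Module.Finite A M ∧ IsBrick A M ∧ LeftFinite A M))) ] := by
  have : IsArtinianRing A := IsArtinianRing.of_finite K A
  tfae_have 1 → 2 := finite_bricks
  tfae_have 2 → 3 := finite_isoClasses_of_imp fun M hM => ⟨hM.1, hM.2.1⟩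
  tfae_have 3 → 1 := fun h => finite_torsionClasses K (finite_functoriallyFinite K h)
  tfae_finish
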